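/- Let |ψ⟩ be a stabilizer state on n qubits such that for every M ∈ 𝒮(ψ) whose support is not a minimal support, there exists a minimal support ω′ of 𝒮(ψ) strictly contained in supp(M) with A_{ω′}(ψ) = 3. Then 𝒮(ψ) = ℳ(ψ), i.e., 𝒮(ψ) is generated by its minimal elements. -/

import Mathlib

open Matrix

noncomputable section

/-- Pauli matrices: `0 ↦ σ₀` (identity), `1 ↦ σₓ`, `2 ↦ σ_y`, `3 ↦ σ_z`. -/
def pauliMat : Fin 4 → Matrix (Fin 2) (Fin 2) ℂ :=
  ![1, !![0, 1; 1, 0], !![0, -Complex.I; Complex.I, 0], !![1, 0; 0, -1]]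

/-- Tensor (Kronecker) product of a family of one-qubit operators, as an operator
on qubits indexed by `ι`. -/
def kron {ι : Type} [Fintype ι] (U : ι → Matrix (Fin 2) (Fin 2) ℂ) :
    Matrix (ι → Fin 2) (ι → Fin 2) ℂ :=
  Matrix.of fun x y => ∏ i, U i (x i) (y i)

/-- An element of the Pauli group: a phase in `{1, -1, i, -i}` together with a
Pauli label (`σ₀, σₓ, σ_y, σ_z`) on every qubit. -/
structure PauliOp (ι : Type) where
  phase : ℂ
  label : ι → Fin 4
  phase_ok : phase = 1 ∨ phase = -1 ∨ phase = Complex.I ∨ phase = -Complex.I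

noncomputable instance {ι : Type} : DecidableEq (PauliOp ι) := Classical.decEq _

/-- The matrix of a Pauli group element. -/
def PauliOp.toMatrix {ι : Type} [Fintype ι] (M : PauliOp ι) :
    Matrix (ι → Fin 2) (ι → Fin 2) ℂ :=
  M.phase • kron fun i => pauliMat (M.label i)

/-- The support of a Pauli operator: the set of qubits on which it acts nontrivially. -/
def PauliOp.support {ι : Type} [Fintype ι] [DecidableEq ι] (M : PauliOp ι) : Finset ι :=
  Finset.univ.filter fun i => M.label i ≠ 0

/-- A (maximal) stabilizer on the qubits indexed by `ι`: an abelian subgroup of the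
Pauli group of cardinality `2^|ι|` which does not contain `-I`. -/
structure Stabilizer (ι : Type) [Fintype ι] [DecidableEq ι] where
  elems : Finset (PauliOp ι)
  one_mem : ∃ M ∈ elems, PauliOp.toMatrix M = 1
  mul_mem : ∀ M ∈ elems, ∀ N ∈ elems, ∃ K ∈ elems,
    PauliOp.toMatrix K = PauliOp.toMatrix M * PauliOp.toMatrix N
  comm : ∀ M ∈ elems, ∀ N ∈ elems,
    PauliOp.toMatrix M * PauliOp.toMatrix N = PauliOp.toMatrix N * PauliOp.toMatrix M
  neg_one_not_mem : ∀ M ∈ elems, PauliOp.toMatrix M ≠ -1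
  card_elems : elems.card = 2 ^ Fintype.card ι

variable {ι : Type} [Fintype ι] [DecidableEq ι]

/-- `ψ` is the stabilizer state of the stabilizer `S`: it is a unit vector fixed by
every element of `S`. -/
def stabilizesState (S : Stabilizer ι) (ψ : (ι → Fin 2) → ℂ) : Prop :=
  (∑ x, Complex.normSq (ψ x)) = 1 ∧ ∀ M ∈ S.elems, (PauliOp.toMatrix M).mulVec ψ = ψ

/-- `ψ` is a stabilizer state. -/
def IsStabilizerState (ψ : (ι → Fin 2) → ℂ) : Prop :=
  ∃ S : Stabilizer ι, stabilizesState S ψ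

/-- `A_ω(ψ)`: the number of stabilizer elements with support exactly `ω`. -/
def Aomega (S : Stabilizer ι) (ω : Finset ι) : ℕ :=
  (S.elems.filter fun M => PauliOp.support M = ω).card

/-- `ω` is a minimal support of `S`: it is the support of some element of `S`, and no
element of `S` has nonempty support strictly contained in `ω`. -/
def IsMinimalSupport (S : Stabilizer ι) (ω : Finset ι) : Prop :=
  (∃ M ∈ S.elems, PauliOp.support M = ω) ∧
    ∀ M ∈ S.elems, PauliOp.support M ⊂ ω → PauliOp.support M = ∅

/-- The matrices of the minimal elements of `S` (the elements whose support is a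
minimal support). -/
def minimalMatrices (S : Stabilizer ι) : Set (Matrix (ι → Fin 2) (ι → Fin 2) ℂ) :=
  {A | ∃ M ∈ S.elems, IsMinimalSupport S (PauliOp.support M) ∧ PauliOp.toMatrix M = A}

/-- `M` belongs to the subgroup `ℳ(ψ)` of `S` generated by the minimal elements.
(Every stabilizer element is an involution, so the generated submonoid coincides with
the generated subgroup.) -/
def inMinimalSubgroup (S : Stabilizer ι) (M : PauliOp ι) : Prop :=
  M ∈ S.elems ∧ PauliOp.toMatrix M ∈ Submonoid.closure (minimalMatrices S)

/-- A one-qubit Clifford operation: a unitary mapping each of the three Pauli matrices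
to a Pauli matrix, up to sign, under conjugation. -/
def IsClifford (U : Matrix (Fin 2) (Fin 2) ℂ) : Prop :=
  U ∈ Matrix.unitaryGroup (Fin 2) ℂ ∧
    ∃ π : Equiv.Perm (Fin 3), ∀ u : Fin 3, ∃ s : ℂ, (s = 1 ∨ s = -1) ∧
      U * pauliMat u.succ * Uᴴ = s • pauliMat (π u).succ

/-- Local unitary equivalence of pure states. -/
def LUequiv (ψ φ : (ι → Fin 2) → ℂ) : Prop :=
  ∃ U : ι → Matrix (Fin 2) (Fin 2) ℂ,
    (∀ i, U i ∈ Matrix.unitaryGroup (Fin 2) ℂ) ∧ (kron U).mulVec ψ = φ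

/-- Local Clifford equivalence of pure states. -/
def LCequiv (ψ φ : (ι → Fin 2) → ℂ) : Prop :=
  ∃ U : ι → Matrix (Fin 2) (Fin 2) ℂ,
    (∀ i, IsClifford (U i)) ∧ (kron U).mulVec ψ = φ

/-- Local Clifford equivalence of (possibly mixed) states. -/
def LCequivMixed (ρ ρ' : Matrix (ι → Fin 2) (ι → Fin 2) ℂ) : Prop :=
  ∃ U : ι → Matrix (Fin 2) (Fin 2) ℂ,
    (∀ i, IsClifford (U i)) ∧ kron U * ρ * (kron U)ᴴ = ρ'

/-- A pure state is fully entangled if it is not a tensor product of states on two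
complementary nonempty subsets of the qubits. -/
def FullyEntangled (ψ : (ι → Fin 2) → ℂ) : Prop :=
  ¬ ∃ (ω : Finset ι) (φ : ({i // i ∈ ω} → Fin 2) → ℂ) (χ : ({i // i ∉ ω} → Fin 2) → ℂ),
      ω ≠ ∅ ∧ ω ≠ Finset.univ ∧
        ∀ x : ι → Fin 2, ψ x = φ (fun i => x i.1) * χ (fun i => x i.1)

/-- Recombine an assignment on `ω` and one on its complement into a global assignment. -/
def mergeAssign (ω : Finset ι) (x : {i // i ∈ ω} → Fin 2) (z : {i // i ∉ ω} → Fin 2) :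
    ι → Fin 2 :=
  fun i => if h : i ∈ ω then x ⟨i, h⟩ else z ⟨i, h⟩

/-- The reduced density matrix `ρ_ω(ψ)` of the pure state `ψ` on the qubits in `ω`
(partial trace of `|ψ⟩⟨ψ|` over the qubits outside `ω`). -/
def reducedState (ψ : (ι → Fin 2) → ℂ) (ω : Finset ι) :
    Matrix ({i // i ∈ ω} → Fin 2) ({i // i ∈ ω} → Fin 2) ℂ :=
  Matrix.of fun x y =>
    ∑ z : {i // i ∉ ω} → Fin 2, ψ (mergeAssign ω x z) * (starRingEnd ℂ) (ψ (mergeAssign ω y z))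

/-- The restriction `α_M M_{i₁} ⊗ ⋯ ⊗ M_{i_k}` of a Pauli operator to the qubits in `ω`. -/
def PauliOp.restrict (M : PauliOp ι) (ω : Finset ι) :
    Matrix ({i // i ∈ ω} → Fin 2) ({i // i ∈ ω} → Fin 2) ℂ :=
  M.phase • kron fun i : {i // i ∈ ω} => pauliMat (M.label i.1)

/-- The `n`-qubit GHZ state `(|0…0⟩ + |1…1⟩)/√2`. -/
def ghz (n : ℕ) : (Fin n → Fin 2) → ℂ :=
  fun x => if x = (fun _ => 0) ∨ x = (fun _ => 1) then ((Real.sqrt 2 : ℝ)⁻¹ : ℂ) else 0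

/-- The `2n × 2n` binary symplectic form `P = [[0, I], [I, 0]]`. -/
def Pmat (n : ℕ) : Matrix (Fin n ⊕ Fin n) (Fin n ⊕ Fin n) (ZMod 2) :=
  Matrix.fromBlocks 0 1 1 0

end

lemma pauliMat_mul (a b : Fin 4) :
    ∃ c : ℂ, c ≠ 0 ∧ ∃ k : Fin 4, pauliMat a * pauliMat b = c • pauliMat k ∧ (k = 0 ↔ a = b) := by
  have hI : (-Complex.I) ≠ 0 := neg_ne_zero.2 Complex.I_ne_zero
  have key : ∀ (c : ℂ) (k : Fin 4), c ≠ 0 → pauliMat a * pauliMat b = c • pauliMat k →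
      (k = 0 ↔ a = b) → ∃ c : ℂ, c ≠ 0 ∧ ∃ k : Fin 4,
        pauliMat a * pauliMat b = c • pauliMat k ∧ (k = 0 ↔ a = b) :=
    fun c k hc h h' => ⟨c, hc, k, h, h'⟩
  fin_cases a <;> fin_cases b
  on_goal 1 => apply key 1 0
  on_goal 4 => apply key 1 1
  on_goal 7 => apply key 1 2
  on_goal 10 => apply key 1 3
  on_goal 13 => apply key 1 1
  on_goal 16 => apply key 1 0
  on_goal 19 => apply key Complex.I 3
  on_goal 22 => apply key (-Complex.I) 2
  on_goal 25 => apply key 1 2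
  on_goal 28 => apply key (-Complex.I) 3
  on_goal 31 => apply key 1 0
  on_goal 34 => apply key Complex.I 1
  on_goal 37 => apply key 1 3
  on_goal 40 => apply key Complex.I 2
  on_goal 43 => apply key (-Complex.I) 1
  on_goal 46 => apply key 1 0
  all_goals first
    | exact one_ne_zero
    | exact Complex.I_ne_zero
    | exact hI
    | decide
    | simp [pauliMat, Matrix.one_fin_two]

lemma trace_pauliMat_mul (a b : Fin 4) :
    (pauliMat a * pauliMat b).trace = if a = b then 2 else 0 := by
  fin_cases a <;> fin_cases b <;>
    simp [pauliMat, Matrix.one_fin_two, Matrix.trace_fin_two, one_add_one_eq_two]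

lemma kron_smul {ι : Type} [Fintype ι] (c : ι → ℂ) (U : ι → Matrix (Fin 2) (Fin 2) ℂ) :
    kron (fun i => c i • U i) = (∏ i, c i) • kron U := by
  ext x y
  simp [kron, Finset.prod_mul_distrib]

lemma PauliOp.phase_ne_zero {ι : Type} (M : PauliOp ι) : M.phase ≠ 0 := by
  rcases M.phase_ok with h | h | h | h <;> simp [h]

section Pauli

variable {ι : Type} [Fintype ι] [DecidableEq ι]

lemma kron_mul (U V : ι → Matrix (Fin 2) (Fin 2) ℂ) :
    kron U * kron V = kron fun i => U i * V i := by
  ext x y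
  simp only [kron, Matrix.mul_apply, Matrix.of_apply, ← Finset.prod_mul_distrib]
  exact (Fintype.prod_sum fun i j => U i (x i) j * V i j (y i)).symm

lemma trace_kron (U : ι → Matrix (Fin 2) (Fin 2) ℂ) :
    (kron U).trace = ∏ i, (U i).trace := by
  simp only [kron, Matrix.trace, Matrix.diag, Matrix.of_apply]
  exact (Fintype.prod_sum fun i j => U i j j).symm

lemma label_eq_of_kron_eq_smul {a b : ι → Fin 4} {c d : ℂ} (hc : c ≠ 0)
    (h : c • kron (fun i => pauliMat (a i)) = d • kron fun i => pauliMat (b i)) : a = b := by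
  have h' := congrArg (fun A => (A * kron fun i => pauliMat (a i)).trace) h
  simp only [Matrix.smul_mul, Matrix.trace_smul, kron_mul, trace_kron, trace_pauliMat_mul,
    if_true, smul_eq_mul] at h'
  have hne : ∏ i, (if b i = a i then (2 : ℂ) else 0) ≠ 0 := by
    intro h0
    rw [h0, mul_zero] at h'
    simp [hc] at h'
  ext1 i
  by_contra hi
  exact hne (Finset.prod_eq_zero (Finset.mem_univ i) (if_neg (Ne.symm hi)))

lemma PauliOp.label_eq_zero_iff_of_toMatrix_eq_mul {K M N : PauliOp ι}
    (h : K.toMatrix = M.toMatrix * N.toMatrix) (i : ι) :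
    K.label i = 0 ↔ M.label i = N.label i := by
  choose c _ k hk hk0 using fun i => pauliMat_mul (M.label i) (N.label i)
  simp only [PauliOp.toMatrix, Matrix.smul_mul, Matrix.mul_smul, kron_mul, hk, kron_smul,
    smul_smul] at h
  rw [label_eq_of_kron_eq_smul K.phase_ne_zero h]
  exact hk0 i

lemma PauliOp.mem_support {M : PauliOp ι} {i : ι} : i ∈ M.support ↔ M.label i ≠ 0 := by
  simp [PauliOp.support]

lemma PauliOp.mem_support_of_toMatrix_eq_mul {K M N : PauliOp ι}
    (h : K.toMatrix = M.toMatrix * N.toMatrix) (i : ι) :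
    i ∈ K.support ↔ M.label i ≠ N.label i := by
  rw [PauliOp.mem_support, Ne, PauliOp.label_eq_zero_iff_of_toMatrix_eq_mul h]

lemma PauliOp.support_subset_of_toMatrix_eq_mul {K M N : PauliOp ι}
    (h : K.toMatrix = M.toMatrix * N.toMatrix) {ω : Finset ι}
    (hM : M.support ⊆ ω) (hN : N.support ⊆ ω) : K.support ⊆ ω := by
  intro i hi
  rw [PauliOp.mem_support_of_toMatrix_eq_mul h] at hi
  by_contra hω
  have hMi : M.label i = 0 := by
    by_contra h0
    exact hω (hM (PauliOp.mem_support.2 h0))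
  have hNi : N.label i = 0 := by
    by_contra h0
    exact hω (hN (PauliOp.mem_support.2 h0))
  exact hi (hMi.trans hNi.symm)

variable {S : Stabilizer ι} {ψ : (ι → Fin 2) → ℂ}

lemma stabilizesState.ne_zero (hψ : stabilizesState S ψ) : ψ ≠ 0 := by
  rintro rfl
  simpa using hψ.1

lemma stabilizesState.eq_of_label_eq (hψ : stabilizesState S ψ) {M N : PauliOp ι}
    (hM : M ∈ S.elems) (hN : N ∈ S.elems) (h : M.label = N.label) : M = N := by
  have h1 := hψ.2 M hM
  have h2 := hψ.2 N hN
  simp only [PauliOp.toMatrix, Matrix.smul_mulVec, h] at h1 h2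
  have hv : (kron fun i => pauliMat (N.label i)).mulVec ψ ≠ 0 := by
    intro h0
    rw [h0, smul_zero] at h2
    exact hψ.ne_zero h2.symm
  have hp : M.phase = N.phase := smul_left_injective ℂ hv (h1.trans h2.symm)
  cases M
  cases N
  simp_all

lemma stabilizesState.eq_of_support_eq_empty (hψ : stabilizesState S ψ) {M N : PauliOp ι}
    (hM : M ∈ S.elems) (hN : N ∈ S.elems) (hM0 : M.support = ∅) (hN0 : N.support = ∅) :
    M = N := by
  refine hψ.eq_of_label_eq hM hN (funext fun i => ?_)
  have h1 : i ∉ M.support := by simp [hM0]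
  have h2 : i ∉ N.support := by simp [hN0]
  rw [PauliOp.mem_support, not_not] at h1 h2
  rw [h1, h2]

lemma stabilizesState.toMatrix_mul_self (hψ : stabilizesState S ψ) {M : PauliOp ι}
    (hM : M ∈ S.elems) : M.toMatrix * M.toMatrix = 1 := by
  obtain ⟨K, hK, hKM⟩ := S.mul_mem M hM M hM
  obtain ⟨E, hE, hE1⟩ := S.one_mem
  have hK0 : K.support = ∅ := by
    ext i
    simp [PauliOp.mem_support_of_toMatrix_eq_mul hKM]
  have hE0 : E.support = ∅ := by
    ext i
    simp [PauliOp.mem_support_of_toMatrix_eq_mul (K := E) (M := E) (N := E) (by simp [hE1])]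
  rw [← hKM, hψ.eq_of_support_eq_empty hK hE hK0 hE0, hE1]

/-- Distinct stabilizer elements with the same minimal support differ on every qubit of it. -/
lemma stabilizesState.label_ne_of_isMinimalSupport (hψ : stabilizesState S ψ) {M N : PauliOp ι}
    (hM : M ∈ S.elems) (hN : N ∈ S.elems) (hMN : M ≠ N) {ω : Finset ι}
    (hω : IsMinimalSupport S ω) (hMω : M.support = ω) (hNω : N.support = ω) {i : ι}
    (hi : i ∈ ω) : M.label i ≠ N.label i := by
  obtain ⟨K, hK, hKMN⟩ := S.mul_mem M hM N hN
  rw [← PauliOp.mem_support_of_toMatrix_eq_mul hKMN]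
  by_contra hiK
  have hss : K.support ⊂ ω :=
    Finset.ssubset_iff_subset_ne.2
      ⟨PauliOp.support_subset_of_toMatrix_eq_mul hKMN hMω.subset hNω.subset,
        fun h => hiK (h ▸ hi)⟩
  have h0 := hω.2 K hK hss
  refine hMN (hψ.eq_of_label_eq hM hN (funext fun j => ?_))
  by_contra hj
  have hmem := (PauliOp.mem_support_of_toMatrix_eq_mul hKMN j).2 hj
  simp [h0] at hmem

/-- If a minimal support carries three stabilizer elements, then every nonidentity Pauli
label at a given qubit of it is realized by one of them. -/
lemma stabilizesState.exists_label_eq (hψ : stabilizesState S ψ) {ω : Finset ι}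
    (hω : IsMinimalSupport S ω) (hA : Aomega S ω = 3) {i : ι} (hi : i ∈ ω) {a : Fin 4}
    (ha : a ≠ 0) : ∃ N ∈ S.elems, N.support = ω ∧ N.label i = a := by
  obtain ⟨P, Q, R, hPQ, hPR, hQR, hset⟩ := Finset.card_eq_three.1 hA
  have hmem : ∀ N, N = P ∨ N = Q ∨ N = R → N ∈ S.elems ∧ N.support = ω := fun N hN => by
    refine Finset.mem_filter.1 (hset ▸ ?_ : N ∈ S.elems.filter fun M => M.support = ω)
    simpa using hN
  obtain ⟨hP, hPω⟩ := hmem P (by simp)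
  obtain ⟨hQ, hQω⟩ := hmem Q (by simp)
  obtain ⟨hR, hRω⟩ := hmem R (by simp)
  have hpigeon : ∀ p q r a : Fin 4, p ≠ 0 → q ≠ 0 → r ≠ 0 → p ≠ q → p ≠ r → q ≠ r → a ≠ 0 →
      p = a ∨ q = a ∨ r = a := by decide
  rcases hpigeon _ _ _ a (PauliOp.mem_support.1 (hPω ▸ hi)) (PauliOp.mem_support.1 (hQω ▸ hi))
    (PauliOp.mem_support.1 (hRω ▸ hi))
    (hψ.label_ne_of_isMinimalSupport hP hQ hPQ hω hPω hQω hi)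
    (hψ.label_ne_of_isMinimalSupport hP hR hPR hω hPω hRω hi)
    (hψ.label_ne_of_isMinimalSupport hQ hR hQR hω hQω hRω hi) ha with h | h | h
  exacts [⟨P, hP, hPω, h⟩, ⟨Q, hQ, hQω, h⟩, ⟨R, hR, hRω, h⟩]

lemma stabilizesState.nonempty_of_one_lt_Aomega (hψ : stabilizesState S ψ) {ω : Finset ι}
    (hA : 1 < Aomega S ω) : ω.Nonempty := by
  obtain ⟨P, hP, Q, hQ, hPQ⟩ := Finset.one_lt_card.1 hA
  rw [Finset.mem_filter] at hP hQ
  rw [Finset.nonempty_iff_ne_empty]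
  rintro rfl
  exact hPQ (hψ.eq_of_support_eq_empty hP.1 hQ.1 hP.2 hQ.2)

end Pauli

/-- If for every stabilizer element with nonminimal support there is a
minimal support `ω'` strictly contained in its support with `A_{ω'}(ψ) = 3`, then `𝒮(ψ)`
is generated by its minimal elements, i.e. `𝒮(ψ) = ℳ(ψ)`. -/
theorem stmt_16 {n : ℕ} (S : Stabilizer (Fin n)) (ψ : (Fin n → Fin 2) → ℂ)
    (hψ : stabilizesState S ψ)
    (hcond : ∀ M ∈ S.elems, ¬ IsMinimalSupport S (PauliOp.support M) →
      ∃ ω' : Finset (Fin n),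
        IsMinimalSupport S ω' ∧ ω' ⊂ PauliOp.support M ∧ Aomega S ω' = 3) :
    ∀ M ∈ S.elems, inMinimalSubgroup S M := by
  intro M hM
  refine ⟨hM, ?_⟩
  induction hcard : M.support.card using Nat.strong_induction_on generalizing M with
  | _ m ih =>
    by_cases hmin : IsMinimalSupport S M.support
    · exact Submonoid.subset_closure ⟨M, hM, hmin, rfl⟩
    obtain ⟨ω, hω, hωM, hA⟩ := hcond M hM hmin
    obtain ⟨i, hi⟩ := hψ.nonempty_of_one_lt_Aomega (hA ▸ by norm_num : 1 < Aomega S ω)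
    have hiM := hωM.1 hi
    obtain ⟨N, hN, hNω, hNi⟩ := hψ.exists_label_eq hω hA hi (PauliOp.mem_support.1 hiM)
    obtain ⟨K, hK, hKMN⟩ := S.mul_mem M hM N hN
    have hss : K.support ⊂ M.support := by
      refine Finset.ssubset_iff_subset_ne.2
        ⟨PauliOp.support_subset_of_toMatrix_eq_mul hKMN subset_rfl (hNω ▸ hωM.1), fun h => ?_⟩
      rw [← h, PauliOp.mem_support_of_toMatrix_eq_mul hKMN] at hiM
      exact hiM hNi.symm
    have hKmem := ih _ (hcard ▸ Finset.card_lt_card hss) K hK rfl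
    have hNmem : N.toMatrix ∈ Submonoid.closure (minimalMatrices S) :=
      Submonoid.subset_closure ⟨N, hN, hNω ▸ hω, rfl⟩
    have hMKN : M.toMatrix = K.toMatrix * N.toMatrix := by
      rw [hKMN, mul_assoc, hψ.toMatrix_mul_self hN, mul_one]
    rw [hMKN]
    exact mul_mem hKmem hNmem
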